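/- A real number q > 1 belongs to the closure of the set U of univoque numbers if and only if the quasi-greedy expansion (α_i) of the number 1 in base q satisfies: for every k ≥ 1, the conjugated shifted sequence (α₁ − α_{k+i})_{i≥1} is lexicographically strictly smaller than (α_i)_{i≥1}. -/

import Mathlib

open Classical

noncomputable section

/-- The largest digit in base `q`: `α₁ = ⌈q⌉ - 1`. -/
def alphaOne (q : ℝ) : ℕ := (⌈q⌉ - 1).toNat

/-- `c` (0-indexed: `c i` is the digit `c_{i+1}` of the paper) is an expansion of `x`
in base `q`: all digits lie in `{0, …, α₁}` and `x = ∑_{i≥1} c_i q^{-i}`. -/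
def IsExpansionOf (q x : ℝ) (c : ℕ → ℕ) : Prop :=
  (∀ i, c i ≤ alphaOne q) ∧ x = ∑' i, (c i : ℝ) / q ^ (i + 1)

/-- A sequence is called infinite if it has infinitely many nonzero terms. -/
def InfiniteSeq (c : ℕ → ℕ) : Prop := {i | c i ≠ 0}.Infinite

/-- Strict lexicographic order on sequences. -/
def LexLt (a b : ℕ → ℕ) : Prop := ∃ n, (∀ i, i < n → a i = b i) ∧ a n < b n

/-- Lexicographic order `≤` on sequences. -/
def LexLe (a b : ℕ → ℕ) : Prop := LexLt a b ∨ a = b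

/-- `b` is the greedy (lexicographically largest) expansion of `x` in base `q`. -/
def IsGreedyOf (q x : ℝ) (b : ℕ → ℕ) : Prop :=
  IsExpansionOf q x b ∧ ∀ c, IsExpansionOf q x c → LexLe c b

/-- `a` is the quasi-greedy (lexicographically largest infinite) expansion of `x`
in base `q`. -/
def IsQuasiGreedyOf (q x : ℝ) (a : ℕ → ℕ) : Prop :=
  IsExpansionOf q x a ∧ InfiniteSeq a ∧
    ∀ c, IsExpansionOf q x c → InfiniteSeq c → LexLe c a

/-- The quasi-greedy expansion of `x` in base `q`; by convention it is the zero
sequence whenever no infinite expansion exists (in particular for `x = 0`). -/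
def quasiGreedy (q x : ℝ) : ℕ → ℕ :=
  if h : ∃ a, IsQuasiGreedyOf q x a then h.choose else fun _ => 0

/-- The greedy expansion of `x` in base `q` (zero sequence if `x` has no expansion). -/
def greedy (q x : ℝ) : ℕ → ℕ :=
  if h : ∃ b, IsGreedyOf q x b then h.choose else fun _ => 0

/-- The interval `J_q = [0, α₁/(q-1)]`. -/
def Jq (q : ℝ) : Set ℝ := Set.Icc 0 ((alphaOne q : ℝ) / (q - 1))

/-- `U_q`: the set of real numbers having exactly one expansion in base `q`. -/
def Uq (q : ℝ) : Set ℝ := {x | ∃! c, IsExpansionOf q x c}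

/-- `U_q'`: the set of univoque sequences in base `q`. -/
def UqSeq (q : ℝ) : Set (ℕ → ℕ) := {c | ∃ x ∈ Uq q, IsExpansionOf q x c}

/-- `U`: the set of univoque numbers. -/
def USet : Set ℝ := {q | 1 < q ∧ ∃! c, IsExpansionOf q 1 c}

/-- `V_q`: the set of `x ∈ J_q` such that for every `n ≥ 1` with `a_n(x) > 0` the
conjugated shifted quasi-greedy expansion is lexicographically at most `(α_i)`. -/
def Vq (q : ℝ) : Set ℝ :=
  {x | x ∈ Jq q ∧ ∀ n, 0 < quasiGreedy q x n →
    LexLe (fun i => alphaOne q - quasiGreedy q x (n + 1 + i)) (quasiGreedy q 1)}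

/-- `V`: the set of `q > 1` whose quasi-greedy expansion `(α_i)` of `1` satisfies
`(α₁ - α_{k+i})_{i≥1} ≤ (α_i)_{i≥1}` lexicographically for all `k ≥ 1`. -/
def VSet : Set ℝ :=
  {q | 1 < q ∧ ∀ k, LexLe (fun i => alphaOne q - quasiGreedy q 1 (k + 1 + i)) (quasiGreedy q 1)}

/-! ### Lexicographic combinatorics -/

/-- `x` is the first position where `a` and `b` differ, and `a x < b x`. -/
def FirstLt (a b : ℕ → ℕ) (x : ℕ) : Prop := (∀ i, i < x → a i = b i) ∧ a x < b x

lemma FirstLt.unique {a b : ℕ → ℕ} {x y : ℕ} (hx : FirstLt a b x) (hy : FirstLt a b y) :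
    x = y := by
  rcases lt_trichotomy x y with h | h | h
  · exact absurd (hy.1 x h) hx.2.ne
  · exact h
  · exact absurd (hx.1 y h) hy.2.ne

/-- If `a` dominates each of its shifts, then lowering a shift of `a` at position `N`
produces a sequence which is smaller than `a` at some position `≤ N`. -/
lemma exists_firstLt_of_shift {a g : ℕ → ℕ} {j N : ℕ}
    (hup : ∀ x, (∀ i, i < x → a (j + i) = a i) → a (j + x) ≤ a x)
    (hg : ∀ i, i < N → g i = a (j + i)) (hN : g N < a (j + N)) :
    ∃ x ≤ N, FirstLt g a x := by
  by_cases h : ∃ x, x < N ∧ g x ≠ a x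
  · have hs := Nat.find_spec h
    have hm : ∀ i, i < Nat.find h → g i = a i := fun i hi => by
      have := Nat.find_min h hi
      push Not at this
      exact this (hi.trans hs.1)
    refine ⟨Nat.find h, hs.1.le, hm, lt_of_le_of_ne ?_ hs.2⟩
    rw [hg _ hs.1]
    exact hup _ fun i hi => by rw [← hg i (hi.trans hs.1), hm i hi]
  · push Not at h
    exact ⟨N, le_rfl, h, hN.trans_le (hup N fun i hi => by rw [← hg i hi, h i hi])⟩

/-- There are arbitrarily large `e` such that, for every `j < e`, the conjugate of the shift
by `j` is already smaller than `a` within the first `e` letters. -/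
lemma exists_good_length {A : ℕ} {a d : ℕ → ℕ}
    (hup : ∀ j x, (∀ i, i < x → a (j + i) = a i) → a (j + x) ≤ a x)
    (hd : ∀ j, FirstLt (fun i => A - a (j + i)) a (d j)) (n : ℕ) :
    ∃ e, n < e ∧ ∀ j, j < e → j + d j < e := by
  by_cases h : ∃ j, j < n + 1 ∧ n + 1 ≤ j + d j
  · have hs := Nat.find_spec h
    have hm : ∀ i, i < Nat.find h → i + d i < n + 1 := fun i hi => by
      have := Nat.find_min h hi
      push Not at this
      exact this (hi.trans hs.1)
    set j := Nat.find h
    refine ⟨j + d j + 1, by omega, fun i hi => ?_⟩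
    rcases lt_trichotomy i j with hij | rfl | hij
    · have := hm i hij
      omega
    · omega
    · obtain ⟨s, rfl⟩ := Nat.exists_eq_add_of_lt hij
      obtain ⟨x, hx, hf⟩ := exists_firstLt_of_shift (a := a)
        (g := fun i => A - a (j + s + 1 + i)) (j := s + 1) (N := d j - (s + 1)) (hup _)
        (fun i hi => by
          have := (hd j).1 (s + 1 + i) (by omega)
          simpa only [add_assoc] using this)
        (by
          have := (hd j).2
          have e1 : s + 1 + (d j - (s + 1)) = d j := by omega
          have e2 : j + s + 1 + (d j - (s + 1)) = j + d j := by omega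
          simpa only [e1, e2] using this)
      have := hf.unique (hd (j + s + 1))
      omega
  · push Not at h
    exact ⟨n + 1, by omega, h⟩

/-- A periodic sequence which dominates its shifts and strictly dominates their conjugates is a
limit of sequences which strictly dominate all their proper shifts and their conjugates. -/
lemma exists_univoque_approx {A k : ℕ} {a : ℕ → ℕ} (hA : ∀ i, a i ≤ A) (h0 : a 0 = A)
    (hup : ∀ j x, (∀ i, i < x → a (j + i) = a i) → a (j + x) ≤ a x)
    (hlow : ∀ j, LexLt (fun i => A - a (j + i)) a) (hk : 0 < k) (hper : ∀ i, a (i + k) = a i)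
    (n : ℕ) :
    ∃ b : ℕ → ℕ, (∀ i, b i ≤ A) ∧ (∀ i, i < n → b i = a i) ∧
      (∀ j, LexLt (fun i => b (j + 1 + i)) b) ∧
      ∀ j, LexLt (fun i => A - b (j + 1 + i)) b := by
  choose d hd using hlow
  change ∀ j, FirstLt _ _ _ at hd
  have hP : Function.Periodic a k := hper
  have hdper : ∀ j, d j = d (j % k) := fun j => by
    refine (hd j).unique ?_
    have : (fun i => A - a (j + i)) = fun i => A - a (j % k + i) := by
      funext i
      rw [← hP.map_mod_nat (j + i), ← hP.map_mod_nat (j % k + i), Nat.mod_add_mod]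
    rw [this]
    exact hd _
  obtain ⟨D, hD⟩ : ∃ D, ∀ j, d j ≤ D :=
    ⟨(Finset.range k).sup d, fun j => by
      rw [hdper]
      exact Finset.le_sup (f := d) (Finset.mem_range.2 (Nat.mod_lt _ hk))⟩
  obtain ⟨m, hm, hmg⟩ := exists_good_length hup hd (2 * D + 2)
  obtain ⟨M, hM, hMg⟩ := exists_good_length hup hd (m + n)
  let v : ℕ → ℕ → ℕ := fun e i => if i + 1 = e then a i - 1 else a i
  let t : ℕ → ℕ := fun i => v m (i % m)
  let b : ℕ → ℕ := fun i => if i < M then v M i else t (i - M)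
  have hv : ∀ e i, i + 1 < e → v e i = a i := fun e i h => if_neg (by omega)
  have hv' : ∀ e i, i + 1 = e → v e i = a i - 1 := fun e i h => if_pos h
  have hba : ∀ i, i + 1 < M → b i = a i := fun i hi => by
    simp only [b, if_pos (show i < M by omega), hv M i hi]
  have hbt : ∀ i, b (M + i) = t i := fun i => by
    simp only [b, if_neg (show ¬ M + i < M by omega), Nat.add_sub_cancel_left]
  have hta : ∀ i, i + 1 < m → t i = a i := fun i hi => by
    simp only [t, Nat.mod_eq_of_lt (show i < m by omega), hv m i hi]
  have hvA : ∀ e i, v e i ≤ A := fun e i => by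
    have := hA i
    simp only [v]
    split_ifs <;> omega
  have block : ∀ n, ∃ e j, j < e ∧ 2 * D + 2 < e ∧ e - j < M ∧ (∀ i, i < e → i + d i < e) ∧
      (∀ i, i < e - j → b (n + 1 + i) = v e (j + i)) ∧
      ∀ i, b (n + 1 + (e - j) + i) = t i := fun n => by
    rcases lt_or_ge (n + 1) M with h | h
    · refine ⟨M, n + 1, h, by omega, by omega, hMg, fun i hi => ?_, fun i => ?_⟩
      · simp only [b, if_pos (show n + 1 + i < M by omega)]
      · rw [show n + 1 + (M - (n + 1)) = M by omega, hbt]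
    · obtain ⟨s, hs⟩ := Nat.exists_eq_add_of_le h
      have hlt : s % m < m := Nat.mod_lt _ (by omega)
      refine ⟨m, s % m, hlt, by omega, by omega, hmg, fun i hi => ?_, fun i => ?_⟩
      · rw [hs, add_assoc, hbt]
        simp only [t]
        rw [Nat.add_mod, Nat.mod_eq_of_lt (show i < m by omega), Nat.mod_eq_of_lt]
        omega
      · rw [hs, add_assoc, add_assoc, hbt]
        simp only [t]
        have h1 := Nat.div_add_mod s m
        rw [show s + (m - s % m + i) = i + m * (s / m + 1) by rw [mul_add]; omega,
          Nat.add_mul_mod_self_left]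
  have hpos : ∀ e, 0 < e → (∀ i, i < e → i + d i < e) → 0 < a (e - 1) := fun e he hg => by
    have h1 := hg (e - 1) (by omega)
    have h2 := (hd (e - 1)).2
    rw [show d (e - 1) = 0 by omega, h0] at h2
    simp only [add_zero] at h2
    omega
  refine ⟨b, fun i => ?_, fun i hi => hba i (by omega), fun n => ?_, fun n => ?_⟩
  · simp only [b, t]
    split_ifs <;> exact hvA _ _
  · obtain ⟨e, j, hje, he, heM, hg, hb, -⟩ := block n
    have hp := hpos e (by omega) hg
    obtain ⟨x, hx, hf⟩ := exists_firstLt_of_shift (a := a) (g := fun i => b (n + 1 + i))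
      (j := j) (N := e - 1 - j) (hup j)
      (fun i hi => by rw [hb i (by omega), hv _ _ (by omega)])
      (by
        rw [hb _ (by omega), hv' _ _ (by omega), show j + (e - 1 - j) = e - 1 by omega]
        omega)
    exact ⟨x, fun i hi => by rw [hba i (by omega)]; exact hf.1 i hi, by
      rw [hba x (by omega)]; exact hf.2⟩
  · obtain ⟨e, j, hje, he, heM, hg, hb, hbt'⟩ := block n
    have hp := hpos e (by omega) hg
    have hx := hg j hje
    have hdj := hd j
    have hbj : ∀ i, i < e - 1 - j → b (n + 1 + i) = a (j + i) := fun i hi => by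
      rw [hb i (by omega), hv _ _ (by omega)]
    have hagree : ∀ i, i < d j → A - b (n + 1 + i) = b i := fun i hi => by
      rw [hbj i (by omega), hba i (by omega)]
      exact hdj.1 i hi
    rcases Nat.lt_or_ge (d j) (e - 1 - j) with h | h
    · refine ⟨d j, hagree, ?_⟩
      simp only
      rw [hbj _ h, hba _ (by omega)]
      exact hdj.2
    · have hN : d j = e - 1 - j := by omega
      have hDj := hD j
      have h1 : b (n + 1 + d j) = a (e - 1) - 1 := by
        rw [hb _ (by omega), hv' _ _ (by omega), hN, show j + (e - 1 - j) = e - 1 by omega]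
      have h2 : b (d j) = a (d j) := hba _ (by omega)
      have h3 := hdj.2
      simp only [hN, show j + (e - 1 - j) = e - 1 by omega] at h3
      rw [← hN] at h3
      have h4 := hA (e - 1)
      rcases Nat.lt_or_ge (A - b (n + 1 + d j)) (b (d j)) with h | h
      · exact ⟨d j, hagree, h⟩
      · set y := d (d j + 1) with hy
        have hyD : y ≤ D := hD _
        have hdy := hd (d j + 1)
        rw [← hy] at hdy
        have ht : ∀ i, i ≤ y → b (n + 1 + (d j + 1 + i)) = a i := fun i hi => by
          have := hbt' i
          rw [show n + 1 + (e - j) + i = n + 1 + (d j + 1 + i) by omega] at this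
          rw [this, hta i (by omega)]
        have hb2 : ∀ i, i ≤ y → b (d j + 1 + i) = a (d j + 1 + i) := fun i hi =>
          hba _ (by omega)
        refine ⟨d j + 1 + y, fun i hi => ?_, ?_⟩
        · rcases lt_trichotomy i (d j) with hi' | rfl | hi'
          · exact hagree i hi'
          · simp only
            omega
          · obtain ⟨s, rfl⟩ := Nat.exists_eq_add_of_lt hi'
            have e1 := ht s (by omega)
            have e2 := hb2 s (by omega)
            have e3 := hdy.1 s (by omega)
            have e4 := hA (d j + 1 + s)
            rw [show d j + s + 1 = d j + 1 + s by omega]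
            simp only at e3 ⊢
            omega
        · have e1 := ht y le_rfl
          have e2 := hb2 y le_rfl
          have e3 := hdy.2
          have e4 := hA (d j + 1 + y)
          have e5 := hA y
          simp only at e3 ⊢
          omega

/-! ### Expansions as orbits -/

/-- `r` is the sequence of tails of an expansion `c` in base `q` with digits at most `A`. -/
structure IsOrbit (q : ℝ) (A : ℕ) (c : ℕ → ℕ) (r : ℕ → ℝ) : Prop where
  digit_le : ∀ i, c i ≤ A
  nonneg : ∀ i, 0 ≤ r i
  le : ∀ i, r i ≤ A / (q - 1)
  succ : ∀ i, r (i + 1) = q * r i - c i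

lemma alphaOne_spec {q : ℝ} (hq : 1 < q) :
    0 < alphaOne q ∧ (alphaOne q : ℝ) < q ∧ q ≤ alphaOne q + 1 := by
  have h1 : (1 : ℤ) < ⌈q⌉ := Int.lt_ceil.2 (by exact_mod_cast hq)
  have h2 : ((alphaOne q : ℤ)) = ⌈q⌉ - 1 := Int.toNat_of_nonneg (by omega)
  have h3 : (alphaOne q : ℝ) = ⌈q⌉ - 1 := by exact_mod_cast congrArg (Int.cast (R := ℝ)) h2
  refine ⟨by omega, ?_, ?_⟩
  · rw [h3]
    linarith [Int.ceil_lt_add_one q]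
  · rw [h3]
    linarith [Int.le_ceil q]

lemma alphaOne_eq {q : ℝ} {A : ℕ} (h1 : (A : ℝ) < q) (h2 : q ≤ A + 1) : alphaOne q = A := by
  have : ⌈q⌉ = (A : ℤ) + 1 := Int.ceil_eq_iff.2 ⟨by push_cast; linarith, by push_cast; linarith⟩
  simp [alphaOne, this]

lemma exists_lt_pow_mul {q y : ℝ} (hq : 1 < q) (hy : 0 < y) (B : ℝ) : ∃ n : ℕ, B < q ^ n * y := by
  obtain ⟨n, hn⟩ := pow_unbounded_of_one_lt (B / y) hq
  exact ⟨n, (div_lt_iff₀ hy).1 hn⟩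

/-- Digits chosen so that the remainders stay in `S` yield a whole orbit inside `S`. -/
lemma exists_orbit_in {q : ℝ} {A : ℕ} {S : Set ℝ}
    (hS : ∀ x ∈ S, ∃ d : ℕ, d ≤ A ∧ q * x - d ∈ S) {x : ℝ} (hx : x ∈ S) :
    ∃ (c : ℕ → ℕ) (r : ℕ → ℝ), r 0 = x ∧ (∀ i, c i ≤ A) ∧ (∀ i, r i ∈ S) ∧
      ∀ i, r (i + 1) = q * r i - c i := by
  choose! f hf hf' using hS
  let r : ℕ → ℝ := fun n => (fun y => q * y - f y)^[n] x
  have hs : ∀ i, r (i + 1) = q * r i - f (r i) := fun i => Function.iterate_succ_apply' _ _ _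
  have hr : ∀ i, r i ∈ S := fun i => by
    induction i with
    | zero => exact hx
    | succ i ih => rw [hs]; exact hf' _ ih
  exact ⟨fun i => f (r i), r, rfl, fun i => hf _ (hr i), hr, hs⟩

lemma exists_orbit {q : ℝ} {A : ℕ} (hq : 1 < q) (hA : q ≤ A + 1) {x : ℝ}
    (hx : x ∈ Set.Icc 0 (A / (q - 1))) : ∃ c r, r 0 = x ∧ IsOrbit q A c r := by
  have hq' : 0 < q - 1 := by linarith
  obtain ⟨c, r, h0, hc, hr, hs⟩ := exists_orbit_in (q := q) (A := A) (S := Set.Icc 0 (A / (q - 1)))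
    (fun x hx => by
      have hx0 : 0 ≤ q * x := mul_nonneg (by linarith) hx.1
      rcases le_or_gt (A : ℝ) (q * x) with h | h
      · refine ⟨A, le_rfl, by linarith, ?_⟩
        have h1 := hx.2
        rw [le_div_iff₀ hq'] at h1 ⊢
        nlinarith
      · have h1 : ⌊q * x⌋₊ < A := (Nat.floor_lt hx0).2 h
        refine ⟨⌊q * x⌋₊, h1.le, by linarith [Nat.floor_le hx0], ?_⟩
        have h2 : 1 ≤ (A : ℝ) / (q - 1) := by rw [le_div_iff₀ hq']; linarith
        linarith [Nat.lt_floor_add_one (q * x)]) hx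
  exact ⟨c, r, h0, hc, fun i => (hr i).1, fun i => (hr i).2, hs⟩

namespace IsOrbit

variable {q : ℝ} {A : ℕ} {c c' : ℕ → ℕ} {r r' : ℕ → ℝ}

lemma shift (h : IsOrbit q A c r) (j : ℕ) :
    IsOrbit q A (fun i => c (j + i)) (fun i => r (j + i)) :=
  ⟨fun _ => h.digit_le _, fun _ => h.nonneg _, fun _ => h.le _, fun i => h.succ (j + i)⟩

lemma conj (h : IsOrbit q A c r) (hq : 1 < q) :
    IsOrbit q A (fun i => A - c i) (fun i => A / (q - 1) - r i) :=
  ⟨fun i => Nat.sub_le _ _, fun i => by linarith [h.le i], fun i => by linarith [h.nonneg i],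
    fun i => by
      have : q - 1 ≠ 0 := by linarith
      rw [h.succ, Nat.cast_sub (h.digit_le i)]
      field_simp
      ring⟩

lemma sub_eq_of_agree (h : IsOrbit q A c r) (h' : IsOrbit q A c' r') {n : ℕ}
    (hc : ∀ i, i < n → c i = c' i) : r' n - r n = q ^ n * (r' 0 - r 0) := by
  induction n with
  | zero => simp
  | succ n ih =>
    have := ih fun i hi => hc i (by omega)
    rw [h.succ, h'.succ, hc n (by omega), pow_succ]
    linear_combination q * this

lemma digit_le_of_agree (h : IsOrbit q A c r) (h' : IsOrbit q A c' r') (hq : 1 < q)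
    (h0 : r 0 ≤ r' 0) (hr : ∀ i, 0 < r i) (hr' : ∀ i, r' i ≤ 1) (x : ℕ)
    (hx : ∀ i, i < x → c i = c' i) : c x ≤ c' x := by
  by_contra! hlt
  have h1 := h.sub_eq_of_agree h' hx
  have h2 : 0 ≤ q ^ x * (r' 0 - r 0) := mul_nonneg (by positivity) (by linarith)
  have h3 : (c' x : ℝ) + 1 ≤ c x := by exact_mod_cast hlt
  have h4 := h.succ x
  have h5 := h'.succ x
  nlinarith [hr (x + 1), hr' (x + 1)]

lemma lexLt (h : IsOrbit q A c r) (h' : IsOrbit q A c' r') (hq : 1 < q)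
    (h0 : r 0 < r' 0) (hr' : ∀ i, r' i ≤ 1) : LexLt c c' := by
  have hex : ∃ x, c x ≠ c' x := by
    by_contra! hall
    obtain ⟨n, hn⟩ := exists_lt_pow_mul hq (sub_pos.2 h0) 1
    have := h.sub_eq_of_agree h' (n := n) fun i _ => hall i
    linarith [h.nonneg n, hr' n]
  have hm : ∀ i, i < Nat.find hex → c i = c' i := fun i hi => by
    simpa using Nat.find_min hex hi
  refine ⟨Nat.find hex, hm, lt_of_le_of_ne ?_ (Nat.find_spec hex)⟩
  set x := Nat.find hex
  by_contra! hlt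
  have h1 := h.sub_eq_of_agree h' hm
  have h2 : 0 < q ^ x * (r' 0 - r 0) := mul_pos (by positivity) (by linarith)
  have h3 : (c' x : ℝ) + 1 ≤ c x := by exact_mod_cast hlt
  have h4 := h.succ x
  have h5 := h'.succ x
  nlinarith [h.nonneg (x + 1), hr' (x + 1)]

lemma eq_of_mem_Ioc (h : IsOrbit q A c r) (h' : IsOrbit q A c' r') (h0 : r 0 = r' 0)
    (hr : ∀ i, r i ∈ Set.Ioc (0 : ℝ) 1) (hr' : ∀ i, r' i ∈ Set.Ioc (0 : ℝ) 1) (i : ℕ) :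
    c i = c' i := by
  have key : ∀ i, r i = r' i → c i = c' i := fun i hi => by
    have h1 := h.succ i
    have h2 := h'.succ i
    have h3 := hr (i + 1)
    have h4 := hr' (i + 1)
    rw [h1, hi] at h3
    rw [h2] at h4
    have h5 : (c i : ℝ) < c' i + 1 := by linarith [h3.1, h4.2]
    have h6 : (c' i : ℝ) < c i + 1 := by linarith [h4.1, h3.2]
    have h7 : c i < c' i + 1 := by exact_mod_cast h5
    have h8 : c' i < c i + 1 := by exact_mod_cast h6
    omega
  have : ∀ i, r i = r' i := fun i => by
    induction i with
    | zero => exact h0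
    | succ i ih => rw [h.succ, h'.succ, key i ih, ih]
  exact key i (this i)

lemma exists_tail_gt (h : IsOrbit q A c r) (h' : IsOrbit q A c' r') (h0 : r' 0 = 1) (hq : 1 < q)
    {n : ℕ} (hn : LexLt (fun i => c (n + i)) c') :
    ∃ x, q ^ (x + 1) * (r n - 1) + r' (x + 1) ≤ r (n + (x + 1)) - 1 := by
  obtain ⟨x, hx, hlt⟩ := hn
  have h1 := (h.shift n).sub_eq_of_agree h' hx
  have h2 := h.succ (n + x)
  have h3 := h'.succ x
  have h4 : (c (n + x) : ℝ) + 1 ≤ c' x := by exact_mod_cast hlt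
  rw [h0] at h1
  simp only [add_zero] at h1
  refine ⟨x, ?_⟩
  rw [← add_assoc, h2, pow_succ]
  nlinarith

lemma tail_le_one (h : IsOrbit q A c r) (h' : IsOrbit q A c' r') (h0 : r' 0 = 1) (hq : 1 < q)
    (hlex : ∀ n, LexLt (fun i => c (n + i)) c') (n : ℕ) : r n ≤ 1 := by
  by_contra! hlt
  have grow : ∀ m : ℕ, ∃ n', q ^ m * (r n - 1) ≤ r n' - 1 := fun m => by
    induction m with
    | zero => exact ⟨n, by simp⟩
    | succ m ih =>
      obtain ⟨n', hn'⟩ := ih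
      obtain ⟨x, hx⟩ := h.exists_tail_gt h' h0 hq (hlex n')
      refine ⟨_, le_trans ?_ hx⟩
      have h1 : 0 ≤ q ^ m * (r n - 1) := mul_nonneg (by positivity) (by linarith)
      have h2 : q ≤ q ^ (x + 1) := le_self_pow₀ hq.le (by omega)
      have h3 := h'.nonneg (x + 1)
      have h4 : q * (r n' - 1) ≤ q ^ (x + 1) * (r n' - 1) :=
        mul_le_mul_of_nonneg_right h2 (by linarith)
      rw [pow_succ]
      nlinarith
  obtain ⟨m, hm⟩ := exists_lt_pow_mul hq (sub_pos.2 hlt) (A / (q - 1))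
  obtain ⟨n', hn'⟩ := grow m
  linarith [h.le n']

lemma tail_lt_one (h : IsOrbit q A c r) (h' : IsOrbit q A c' r') (h0 : r' 0 = 1) (hq : 1 < q)
    (hr' : ∀ i, 0 < r' i) (hlex : ∀ n, LexLt (fun i => c (n + i)) c') (n : ℕ) : r n < 1 := by
  by_contra! hlt
  obtain ⟨x, hx⟩ := h.exists_tail_gt h' h0 hq (hlex n)
  have h1 : 0 ≤ q ^ (x + 1) * (r n - 1) := mul_nonneg (by positivity) (by linarith)
  linarith [h.tail_le_one h' h0 hq hlex (n + (x + 1)), hr' (x + 1)]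

lemma tsum_partial (h : IsOrbit q A c r) (hq : 1 < q) (n : ℕ) :
    ∑ i ∈ Finset.range n, (c i : ℝ) / q ^ (i + 1) = r 0 - r n / q ^ n := by
  have hq0 : q ≠ 0 := by linarith
  induction n with
  | zero => simp
  | succ n ih =>
    rw [Finset.sum_range_succ, ih, h.succ]
    field_simp
    ring

lemma hasSum (h : IsOrbit q A c r) (hq : 1 < q) :
    HasSum (fun i => (c i : ℝ) / q ^ (i + 1)) (r 0) := by
  rw [hasSum_iff_tendsto_nat_of_nonneg fun i => by positivity]
  simp_rw [h.tsum_partial hq]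
  have h1 : Filter.Tendsto (fun n : ℕ => (A / (q - 1)) * (q⁻¹) ^ n) Filter.atTop (nhds 0) := by
    simpa using (tendsto_pow_atTop_nhds_zero_of_lt_one (r := q⁻¹) (by positivity)
      (inv_lt_one_of_one_lt₀ hq)).const_mul (A / (q - 1))
  have h2 : Filter.Tendsto (fun n : ℕ => r n / q ^ n) Filter.atTop (nhds 0) := by
    refine squeeze_zero (fun n => div_nonneg (h.nonneg n) (by positivity)) (fun n => ?_) h1
    rw [inv_pow, ← div_eq_mul_inv]
    exact div_le_div_of_nonneg_right (h.le n) (by positivity)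
  simpa using h2.const_sub (r 0)

end IsOrbit

lemma hasSum_max_digits {q : ℝ} (hq : 1 < q) (A : ℕ) :
    HasSum (fun i : ℕ => (A : ℝ) / q ^ (i + 1)) (A / (q - 1)) := by
  have hq' : q - 1 ≠ 0 := by linarith
  exact IsOrbit.hasSum (A := A) (c := fun _ => A) (r := fun _ => A / (q - 1))
    ⟨fun _ => le_rfl, fun _ => div_nonneg (by positivity) (by linarith), fun _ => le_rfl,
      fun _ => by field_simp; ring⟩ hq

lemma summable_digits {q : ℝ} (hq : 1 < q) {A : ℕ} {c : ℕ → ℕ} (hc : ∀ i, c i ≤ A) :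
    Summable fun i => (c i : ℝ) / q ^ (i + 1) :=
  (hasSum_max_digits hq A).summable.of_nonneg_of_le (fun i => by positivity) fun i =>
    div_le_div_of_nonneg_right (by exact_mod_cast hc i) (by positivity)

lemma isExpansionOf_iff {q x : ℝ} (hq : 1 < q) {c : ℕ → ℕ} :
    IsExpansionOf q x c ↔ ∃ r, r 0 = x ∧ IsOrbit q (alphaOne q) c r := by
  constructor
  · rintro ⟨hc, hx⟩
    have hs : ∀ k, Summable fun i => (c (k + i) : ℝ) / q ^ (i + 1) := fun k =>
      summable_digits hq fun i => hc (k + i)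
    refine ⟨fun k => ∑' i, (c (k + i) : ℝ) / q ^ (i + 1), by simpa using hx.symm, hc,
      fun k => tsum_nonneg fun i => by positivity, fun k => ?_, fun k => ?_⟩
    · rw [← (hasSum_max_digits hq _).tsum_eq]
      exact (hs k).tsum_le_tsum (fun i => div_le_div_of_nonneg_right
        (by exact_mod_cast hc _) (by positivity)) (hasSum_max_digits hq _).summable
    · have hq0 : q ≠ 0 := by linarith
      rw [(hs k).tsum_eq_zero_add, mul_add, ← tsum_mul_left]
      have : ∀ i, q * ((c (k + (i + 1)) : ℝ) / q ^ (i + 1 + 1)) = c (k + 1 + i) / q ^ (i + 1) :=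
        fun i => by
          rw [show k + (i + 1) = k + 1 + i by ring]
          field_simp
          ring
      simp_rw [this]
      field_simp
      simp
  · rintro ⟨r, rfl, h⟩
    exact ⟨h.digit_le, (h.hasSum hq).tsum_eq.symm⟩

lemma LexLt.asymm {a b : ℕ → ℕ} (h : LexLt a b) : ¬ LexLt b a := by
  rintro ⟨y, hy, hy'⟩
  obtain ⟨x, hx, hx'⟩ := h
  rcases lt_trichotomy x y with h | rfl | h
  · exact hx'.ne' (hy x h)
  · omega
  · exact hy'.ne' (hx y h)

lemma LexLe.antisymm {a b : ℕ → ℕ} (h : LexLe a b) (h' : LexLe b a) : a = b := by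
  rcases h with h | h
  · rcases h' with h' | h'
    · exact absurd h' h.asymm
    · exact h'.symm
  · exact h

/-- The tails of an infinite expansion are positive. -/
lemma IsOrbit.pos_of_infinite {q : ℝ} {A : ℕ} {c : ℕ → ℕ} {r : ℕ → ℝ} (h : IsOrbit q A c r)
    (hc : InfiniteSeq c) (k : ℕ) : 0 < r k := by
  refine (h.nonneg k).lt_of_ne' fun hk => hc ?_
  have key : ∀ n, r n = 0 → c n = 0 ∧ r (n + 1) = 0 := fun n hn => by
    have h1 := h.succ n
    have h2 := h.nonneg (n + 1)
    rw [hn] at h1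
    have h3 : (0 : ℝ) ≤ c n := by positivity
    have h4 : (c n : ℝ) = 0 := by linarith
    exact ⟨by exact_mod_cast h4, by linarith⟩
  have hz : ∀ i, r (k + i) = 0 := fun i => by
    induction i with
    | zero => exact hk
    | succ i ih => exact (key _ ih).2
  refine (Set.finite_lt_nat k).subset fun i hi => ?_
  by_contra hik
  obtain ⟨s, rfl⟩ := Nat.exists_eq_add_of_le (not_lt.1 hik)
  exact hi (key _ (hz s)).1

/-- The quasi-greedy expansion of `1` is the one whose tails all lie in `(0, 1]`. -/
lemma exists_orbit_quasiGreedy {q : ℝ} (hq : 1 < q) :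
    ∃ r, r 0 = 1 ∧ IsOrbit q (alphaOne q) (quasiGreedy q 1) r ∧ ∀ k, r k ∈ Set.Ioc (0 : ℝ) 1 := by
  obtain ⟨hApos, hAlt, hAge⟩ := alphaOne_spec hq
  set A := alphaOne q
  obtain ⟨a, r, h0, ha, hr, hs⟩ := exists_orbit_in (q := q) (A := A) (S := Set.Ioc (0 : ℝ) 1)
    (fun x hx => by
      have hx0 : 0 < q * x := mul_pos (by linarith) hx.1
      have h1 : 1 ≤ ⌈q * x⌉₊ := Nat.one_le_iff_ne_zero.2 (Nat.ceil_pos.2 hx0).ne'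
      have h2 : ⌈q * x⌉₊ ≤ A + 1 := Nat.ceil_le.2 (by
        push_cast
        nlinarith [hx.2])
      refine ⟨⌈q * x⌉₊ - 1, by omega, ?_, ?_⟩
      · rw [Nat.cast_sub h1]
        push_cast
        linarith [Nat.ceil_lt_add_one hx0.le]
      · rw [Nat.cast_sub h1]
        push_cast
        linarith [Nat.le_ceil (q * x)]) (x := 1) ⟨one_pos, le_rfl⟩
  have hone : 1 ≤ (A : ℝ) / (q - 1) := by rw [le_div_iff₀ (by linarith)]; linarith
  have ho : IsOrbit q A a r :=
    ⟨ha, fun i => (hr i).1.le, fun i => (hr i).2.trans hone, hs⟩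
  have hqg : IsQuasiGreedyOf q 1 a := by
    refine ⟨(isExpansionOf_iff hq).2 ⟨r, h0, ho⟩, fun hfin => ?_, fun c hc hinf => ?_⟩
    · obtain ⟨N, hN⟩ := hfin.bddAbove
      have hz : ∀ i, a (N + 1 + i) = 0 := fun i => by
        by_contra hne
        have := hN hne
        omega
      have hg : ∀ i, r (N + 1 + i) = q ^ i * r (N + 1) := fun i => by
        induction i with
        | zero => simp
        | succ i ih =>
          rw [← add_assoc, hs, hz, ih]
          push_cast
          ring
      obtain ⟨n, hn⟩ := exists_lt_pow_mul hq (hr (N + 1)).1 1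
      rw [← hg] at hn
      linarith [(hr (N + 1 + n)).2]
    · obtain ⟨s, hs0, hso⟩ := (isExpansionOf_iff hq).1 hc
      by_cases hca : c = a
      · exact Or.inr hca
      · left
        have hex : ∃ x, c x ≠ a x := Function.ne_iff.1 hca
        have hm : ∀ i, i < Nat.find hex → c i = a i := fun i hi => by
          simpa using Nat.find_min hex hi
        exact ⟨Nat.find hex, hm, lt_of_le_of_ne (hso.digit_le_of_agree ho hq (by rw [hs0, h0])
          (hso.pos_of_infinite hinf) (fun i => (hr i).2) _ hm) (Nat.find_spec hex)⟩
  have hex : ∃ a, IsQuasiGreedyOf q 1 a := ⟨a, hqg⟩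
  have heq : quasiGreedy q 1 = a := by
    have hch : IsQuasiGreedyOf q 1 (quasiGreedy q 1) := by
      rw [quasiGreedy, dif_pos hex]
      exact hex.choose_spec
    exact LexLe.antisymm (hqg.2.2 _ hch.1 hch.2.1) (hch.2.2 _ hqg.1 hqg.2.1)
  exact ⟨r, h0, heq ▸ ho, hr⟩

/-! ### Univoque bases in terms of tails -/

lemma mem_USet_of_tails {q : ℝ} (hq : 1 < q) {c : ℕ → ℕ} {r : ℕ → ℝ} (h0 : r 0 = 1)
    (h : IsOrbit q (alphaOne q) c r) (h1 : ∀ k, r (k + 1) < 1)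
    (h2 : ∀ k, alphaOne q / (q - 1) - r (k + 1) < 1) : q ∈ USet := by
  refine ⟨hq, c, (isExpansionOf_iff hq).2 ⟨r, h0, h⟩, fun c' hc' => ?_⟩
  obtain ⟨r', h0', h'⟩ := (isExpansionOf_iff hq).1 hc'
  by_contra hne
  have hex : ∃ x, c' x ≠ c x := Function.ne_iff.1 hne
  have hm : ∀ i, i < Nat.find hex → c' i = c i := fun i hi => by simpa using Nat.find_min hex hi
  have hx := h'.sub_eq_of_agree h hm
  have hs := Nat.find_spec hex
  set x := Nat.find hex
  rw [h0, h0', sub_self, mul_zero, sub_eq_zero] at hx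
  have e1 := h.succ x
  have e2 := h'.succ x
  rw [← hx] at e2
  rcases lt_or_gt_of_ne hs with hlt | hlt
  · have h3 : (c' x : ℝ) + 1 ≤ c x := by exact_mod_cast hlt
    linarith [h2 x, h'.le (x + 1)]
  · have h3 : (c x : ℝ) + 1 ≤ c' x := by exact_mod_cast hlt
    linarith [h1 x, h'.nonneg (x + 1)]

lemma mem_USet_of_eq_alphaOne_add_one {q : ℝ} (hq : 1 < q) (hA : q = alphaOne q + 1) :
    q ∈ USet := by
  have hone : (alphaOne q : ℝ) / (q - 1) = 1 := by
    rw [div_eq_one_iff_eq (by linarith)]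
    linarith
  refine ⟨hq, fun _ => alphaOne q, (isExpansionOf_iff hq).2 ⟨fun _ => 1, rfl, ?_⟩, fun c hc => ?_⟩
  · exact ⟨fun _ => le_rfl, fun _ => zero_le_one, fun _ => hone.ge, fun _ => by linarith⟩
  · obtain ⟨r, h0, h⟩ := (isExpansionOf_iff hq).1 hc
    have key : ∀ i, r i = 1 → c i = alphaOne q ∧ r (i + 1) = 1 := fun i hi => by
      have h1 := h.succ i
      have h2 := h.le (i + 1)
      have h3 : (c i : ℝ) ≤ alphaOne q := by exact_mod_cast h.digit_le i
      rw [hi] at h1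
      rw [hone] at h2
      have h4 : (c i : ℝ) = alphaOne q := by linarith
      exact ⟨by exact_mod_cast h4, by linarith⟩
    have hr : ∀ i, r i = 1 := fun i => by
      induction i with
      | zero => exact h0
      | succ i ih => exact (key i ih).2
    exact funext fun i => (key i (hr i)).1

/-- The digits of a unique expansion are forced. -/
lemma IsOrbit.digit_eq_of_unique {q : ℝ} (hq : 1 < q) {c : ℕ → ℕ} {r : ℕ → ℝ}
    (h : IsOrbit q (alphaOne q) c r)
    (huniq : ∀ c', IsExpansionOf q (r 0) c' → c' = c) {k d : ℕ} (hd : d ≤ alphaOne q)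
    (hx : q * r k - d ∈ Set.Icc 0 (alphaOne q / (q - 1))) : d = c k := by
  obtain ⟨e, s, hs0, hs⟩ := exists_orbit hq (alphaOne_spec hq).2.2 hx
  let c' : ℕ → ℕ := fun i => if i < k then c i else if i = k then d else e (i - (k + 1))
  let r' : ℕ → ℝ := fun i => if i ≤ k then r i else s (i - (k + 1))
  have ho : IsOrbit q (alphaOne q) c' r' := by
    refine ⟨fun i => ?_, fun i => ?_, fun i => ?_, fun i => ?_⟩
    · simp only [c']
      split_ifs
      exacts [h.digit_le _, hd, hs.digit_le _]
    · simp only [r']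
      split_ifs
      exacts [h.nonneg _, hs.nonneg _]
    · simp only [r']
      split_ifs
      exacts [h.le _, hs.le _]
    · rcases lt_trichotomy i k with hi | rfl | hi
      · simp only [r', c', if_pos hi, if_pos hi.le, if_pos (Nat.succ_le_of_lt hi)]
        exact h.succ i
      · simp [r', c', hs0]
      · simp only [r', c', if_neg (show ¬ i < k by omega), if_neg (show ¬ i ≤ k by omega),
          if_neg (show ¬ i = k by omega), if_neg (show ¬ i + 1 ≤ k by omega)]
        rw [show i + 1 - (k + 1) = i - (k + 1) + 1 by omega]
        exact hs.succ _
  have := huniq c' ((isExpansionOf_iff hq).2 ⟨r', by simp [r'], ho⟩)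
  rw [← this]
  simp [c']

lemma exists_orbit_of_mem_USet {q : ℝ} (hqU : q ∈ USet) :
    ∃ c r, r 0 = 1 ∧ IsOrbit q (alphaOne q) c r ∧ (∀ k, r k ≤ 1) ∧
      ∀ k, alphaOne q / (q - 1) - r (k + 1) < 1 := by
  obtain ⟨hq, c, hc, huniq⟩ := hqU
  obtain ⟨hApos, hAlt, hAge⟩ := alphaOne_spec hq
  obtain ⟨r, h0, h⟩ := (isExpansionOf_iff hq).1 hc
  have hdig : ∀ k d, d ≤ alphaOne q → q * r k - d ∈ Set.Icc 0 (alphaOne q / (q - 1)) → d = c k :=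
    fun k d => h.digit_eq_of_unique hq (by rw [h0]; exact huniq)
  have hle : ∀ k, r k ≤ 1 := fun k => by
    induction k with
    | zero => exact h0.le
    | succ k ih =>
      by_contra! hlt
      have h1 := h.succ k
      rcases (h.digit_le k).eq_or_lt with hA | hA
      · rw [hA] at h1
        nlinarith
      · have := hdig k (c k + 1) hA (by
          push_cast
          constructor
          · linarith
          · linarith [h.le (k + 1)])
        omega
  have hlow : ∀ k, 0 < c k → alphaOne q / (q - 1) - r (k + 1) < 1 := fun k hk => by
    by_contra! hlt
    have h1 := h.succ k
    have := hdig k (c k - 1) (by have := h.digit_le k; omega) (by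
      rw [Nat.cast_sub hk]
      push_cast
      constructor
      · linarith [h.nonneg (k + 1)]
      · linarith)
    omega
  refine ⟨c, r, h0, h, hle, fun k => ?_⟩
  induction k with
  | zero =>
    refine hlow 0 (Nat.pos_of_ne_zero fun hz => ?_)
    have h1 := h.succ 0
    rw [hz, h0] at h1
    push_cast at h1
    linarith [hle (0 + 1)]
  | succ k ih =>
    rcases Nat.eq_zero_or_pos (c (k + 1)) with hz | hz
    · have h1 := (h.conj hq).succ (k + 1)
      simp only [hz, Nat.sub_zero] at h1
      rw [h1]
      nlinarith
    · exact hlow _ hz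

/-! ### Limits of univoque bases -/

/-- Digits and tails of univoque bases converging to a non-integer `q` converge to those of the
quasi-greedy expansion. -/
lemma tendsto_tails {q : ℝ} {A : ℕ} (hq : 1 < q) (hqA : q < A + 1) {a : ℕ → ℕ} {r : ℕ → ℝ}
    (h0 : r 0 = 1) (h : IsOrbit q A a r) (hr : ∀ k, r k ∈ Set.Ioc (0 : ℝ) 1)
    {p : ℕ → ℝ} (hp : Filter.Tendsto p Filter.atTop (nhds q)) {b : ℕ → ℕ → ℕ} {s : ℕ → ℕ → ℝ}
    (hb : ∀ᶠ n in Filter.atTop, s n 0 = 1 ∧ IsOrbit (p n) A (b n) (s n) ∧ (∀ k, s n k ≤ 1) ∧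
      ∀ k, A / (p n - 1) - s n (k + 1) < 1) (k : ℕ) :
    Filter.Tendsto (fun n => s n k) Filter.atTop (nhds (r k)) ∧
      ∀ᶠ n in Filter.atTop, b n k = a k := by
  have hδ : Filter.Tendsto (fun n => A / (p n - 1) - 1) Filter.atTop (nhds (A / (q - 1) - 1)) :=
    (tendsto_const_nhds.div (hp.sub_const 1) (by linarith)).sub_const 1
  have hδpos : 0 < A / (q - 1) - 1 := by
    rw [sub_pos, lt_div_iff₀ (by linarith)]
    linarith
  have digit : ∀ k, Filter.Tendsto (fun n => s n k) Filter.atTop (nhds (r k)) →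
      ∀ᶠ n in Filter.atTop, b n k = a k := fun k hk => by
    have hx : Filter.Tendsto (fun n => p n * s n k - a k) Filter.atTop (nhds (r (k + 1))) := by
      rw [h.succ]
      exact (hp.mul hk).sub_const _
    have hup : ∀ᶠ n in Filter.atTop, p n * s n k - a k < 1 + (A / (p n - 1) - 1) :=
      hx.eventually_lt (hδ.const_add 1) (by linarith [(hr (k + 1)).2])
    have hlo : ∀ᶠ n in Filter.atTop, 0 < p n * s n k - a k :=
      hx.eventually_const_lt (hr (k + 1)).1
    filter_upwards [hb, hup, hlo] with n ⟨_, hn, hle, hgt⟩ hu hl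
    have h1 := hn.succ k
    have h2 := hle (k + 1)
    have h3 := hgt k
    have h5 : (a k : ℝ) < b n k + 1 := by linarith
    have h6 : (b n k : ℝ) < a k + 1 := by linarith
    have h7 : a k < b n k + 1 := by exact_mod_cast h5
    have h8 : b n k < a k + 1 := by exact_mod_cast h6
    omega
  have tail : Filter.Tendsto (fun n => s n k) Filter.atTop (nhds (r k)) := by
    induction k with
    | zero =>
      rw [h0]
      exact tendsto_const_nhds.congr' (hb.mono fun n hn => hn.1.symm)
    | succ k ih =>
      rw [h.succ]
      refine ((hp.mul ih).sub_const _).congr' ?_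
      filter_upwards [hb, digit k ih] with n hn hd
      rw [hn.2.1.succ, hd]
  exact ⟨tail, digit k tail⟩

/-- If `q` is a non-integer limit of univoque bases, the conjugated proper tails are `< 1`. -/
lemma conj_tail_lt_one_of_mem_closure {q : ℝ} (hq : 1 < q) (hqA : q < alphaOne q + 1)
    (hcl : q ∈ closure USet) {a : ℕ → ℕ} {r : ℕ → ℝ}
    (h0 : r 0 = 1) (h : IsOrbit q (alphaOne q) a r) (hr : ∀ k, r k ∈ Set.Ioc (0 : ℝ) 1) (k : ℕ) :
    alphaOne q / (q - 1) - r (k + 1) < 1 := by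
  obtain ⟨-, hAlt, -⟩ := alphaOne_spec hq
  set A := alphaOne q
  obtain ⟨p, hpU, hp⟩ := mem_closure_iff_seq_limit.1 hcl
  choose b s hs0 hs hs1 hs2 using fun n => exists_orbit_of_mem_USet (hpU n)
  have hpA : ∀ᶠ n in Filter.atTop, (A : ℝ) < p n ∧ p n < A + 1 :=
    (hp.eventually_const_lt hAlt).and (hp.eventually_lt_const hqA)
  have hb : ∀ᶠ n in Filter.atTop, s n 0 = 1 ∧ IsOrbit (p n) A (b n) (s n) ∧ (∀ k, s n k ≤ 1) ∧
      ∀ k, A / (p n - 1) - s n (k + 1) < 1 := hpA.mono fun n hn => by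
    have := alphaOne_eq hn.1 hn.2.le
    have h1 := hs n
    have h2 := hs2 n
    rw [this] at h1 h2
    exact ⟨hs0 n, h1, hs1 n, h2⟩
  have hlim := tendsto_tails hq hqA h0 h hr hp hb
  have hge : ∀ k, A / (q - 1) - r (k + 1) ≤ 1 := fun k =>
    le_of_tendsto ((tendsto_const_nhds.div (hp.sub_const 1) (by linarith)).sub (hlim (k + 1)).1)
      (hb.mono fun n hn => (hn.2.2.2 k).le)
  by_contra! hlt
  have heq : A / (q - 1) - r (k + 1 + 0) = r 0 := by
    rw [h0]
    exact le_antisymm (hge k) hlt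
  have hone : 1 < (A : ℝ) / (q - 1) := by
    rw [lt_div_iff₀ (by linarith)]
    linarith
  have hconj : ∀ i, A - a (k + 1 + i) = a i := ((h.shift (k + 1)).conj hq).eq_of_mem_Ioc h heq
    (fun i => ⟨by linarith [(hr (k + 1 + i)).2], by
      have := hge (k + i)
      rwa [show k + i + 1 = k + 1 + i by ring] at this⟩) hr
  have hper : ∀ i, a (2 * (k + 1) + i) = a i := fun i => by
    have e1 := hconj i
    have e2 := hconj (k + 1 + i)
    rw [show k + 1 + (k + 1 + i) = 2 * (k + 1) + i by ring] at e2
    have e3 := h.digit_le i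
    have e4 := h.digit_le (2 * (k + 1) + i)
    have e5 := h.digit_le (k + 1 + i)
    omega
  have hfin : ∀ᶠ n in Filter.atTop, ∀ i ∈ Finset.range (2 * (k + 1)), b n i = a i :=
    (Filter.eventually_all_finset _).2 fun i _ => (hlim i).2
  obtain ⟨n, ⟨hn0, hn, hn1, hn2⟩, ⟨-, hnA⟩, hna⟩ := (hb.and (hpA.and hfin)).exists
  have hpn : 1 < p n := (hpU n).1
  have honen : 1 < (A : ℝ) / (p n - 1) := by
    rw [lt_div_iff₀ (by linarith)]
    linarith
  have hpos : ∀ i, 0 < s n i := fun i => by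
    cases i with
    | zero => rw [hn0]; exact one_pos
    | succ i => linarith [hn2 i]
  have hcn := (hn.shift (k + 1)).conj hpn
  have hall : ∀ i, b n i = a i := fun N => by
    induction N using Nat.strong_induction_on with
    | _ N ih =>
      rcases lt_or_ge N (2 * (k + 1)) with hN | hN
      · exact hna N (Finset.mem_range.2 hN)
      obtain ⟨t, rfl⟩ := Nat.exists_eq_add_of_le hN
      have hu := (hn.shift (2 * (k + 1))).digit_le_of_agree hn hpn
        (by rw [hn0]; exact hn1 _) (fun i => hpos _) hn1 t
        (fun i hi => by rw [ih _ (by omega), ih i (by omega), hper])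
      have hl := hcn.digit_le_of_agree hn hpn
        (by rw [hn0]; exact (hn2 k).le) (fun i => by linarith [hn1 (k + 1 + i)]) hn1 (k + 1 + t)
        (fun i hi => by rw [ih _ (by omega), ih i (by omega), hconj])
      have e1 := ih t (by omega)
      have e2 := ih (k + 1 + t) (by omega)
      have e3 := hconj (k + 1 + t)
      have e4 := hper t
      rw [show k + 1 + (k + 1 + t) = 2 * (k + 1) + t by ring] at e3
      simp only [show k + 1 + (k + 1 + t) = 2 * (k + 1) + t by ring] at hl
      have e5 := hn.digit_le (2 * (k + 1) + t)
      have e6 := h.digit_le (2 * (k + 1) + t)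
      omega
  obtain ⟨x, -, hx⟩ := hcn.lexLt hn hpn (by rw [hn0]; exact hn2 k) hn1
  simp only [hall, hconj, lt_irrefl] at hx

/-! ### Approximation by univoque bases -/

/-- A base close to `q` in which a sequence resembling the quasi-greedy expansion represents `1`. -/
lemma exists_base_near {q : ℝ} {A : ℕ} {a : ℕ → ℕ} (ha : ∀ i, a i ≤ A) (ha0 : 0 < a 0)
    (hsum : HasSum (fun i => (a i : ℝ) / q ^ (i + 1)) 1) {b : ℕ → ℕ → ℕ} (hb : ∀ n i, b n i ≤ A)
    (hba : ∀ n i, i < n → b n i = a i) {ε : ℝ} (hε : 0 < ε) (hεq : 1 < q - ε) :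
    ∃ n, ∃ p ∈ Set.Icc (q - ε) (q + ε), 1 = ∑' i, (b n i : ℝ) / p ^ (i + 1) := by
  have lim : ∀ x : ℝ, 1 < x → Filter.Tendsto (fun n => ∑' i, (b n i : ℝ) / x ^ (i + 1))
      Filter.atTop (nhds (∑' i, (a i : ℝ) / x ^ (i + 1))) := fun x hx =>
    tendsto_tsum_of_dominated_convergence (hasSum_max_digits hx A).summable
      (fun i => tendsto_const_nhds.congr' <| by
        filter_upwards [Filter.eventually_gt_atTop i] with n hn
        rw [hba n i hn])
      (Filter.Eventually.of_forall fun n i => by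
        rw [Real.norm_of_nonneg (by positivity)]
        exact div_le_div_of_nonneg_right (by exact_mod_cast hb n i) (by positivity))
  have anti : ∀ x y : ℝ, 1 < x → x < y →
      ∑' i, (a i : ℝ) / y ^ (i + 1) < ∑' i, (a i : ℝ) / x ^ (i + 1) := fun x y hx hxy =>
    Summable.tsum_lt_tsum (i := 0)
      (fun i => div_le_div_of_nonneg_left (by positivity) (by positivity)
        (pow_le_pow_left₀ (by linarith) hxy.le _))
      (by
        have : (0 : ℝ) < a 0 := by exact_mod_cast ha0
        simp only [zero_add, pow_one]
        exact div_lt_div_of_pos_left this (by linarith) hxy)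
      (summable_digits (hx.trans hxy) ha) (summable_digits hx ha)
  have h1 : 1 < ∑' i, (a i : ℝ) / (q - ε) ^ (i + 1) := by
    have := anti (q - ε) q hεq (by linarith)
    rwa [hsum.tsum_eq] at this
  have h2 : ∑' i, (a i : ℝ) / (q + ε) ^ (i + 1) < 1 := by
    have := anti q (q + ε) (by linarith) (by linarith)
    rwa [hsum.tsum_eq] at this
  obtain ⟨n, hn1, hn2⟩ := (((lim _ hεq).eventually_const_lt h1).and
    ((lim (q + ε) (by linarith)).eventually_lt_const h2)).exists
  have hcont : ContinuousOn (fun p : ℝ => ∑' i, (b n i : ℝ) / p ^ (i + 1))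
      (Set.Icc (q - ε) (q + ε)) := by
    refine continuousOn_tsum (fun i => ?_) (hasSum_max_digits hεq A).summable fun i x hx => ?_
    · exact continuousOn_const.div (continuousOn_pow _) fun x hx =>
        pow_ne_zero _ (by linarith [hx.1])
    · have hx0 : 0 < x := by linarith [hx.1]
      rw [Real.norm_of_nonneg (by positivity)]
      exact div_le_div₀ (by positivity) (by exact_mod_cast hb n i) (by positivity)
        (pow_le_pow_left₀ (by linarith) hx.1 _)
  obtain ⟨p, hp, hp1⟩ := intermediate_value_Icc' (by linarith) hcont ⟨hn2.le, hn1.le⟩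
  exact ⟨n, p, hp, hp1.symm⟩

/-- A non-integer base in which a sequence strictly dominating its shifts and their conjugates
represents `1` is univoque. -/
lemma mem_USet_of_lexLt {p : ℝ} (hp : 1 < p) (hpA : p < alphaOne p + 1) {b : ℕ → ℕ}
    (hexp : IsExpansionOf p 1 b) (hup : ∀ j, LexLt (fun i => b (j + 1 + i)) b)
    (hlow : ∀ j, LexLt (fun i => alphaOne p - b (j + 1 + i)) b) : p ∈ USet := by
  obtain ⟨s, hs0, hs⟩ := (isExpansionOf_iff hp).1 hexp
  have hone : 1 < (alphaOne p : ℝ) / (p - 1) := by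
    rw [lt_div_iff₀ (by linarith)]
    linarith
  have hc := (hs.shift 1).conj hp
  have hlow' : ∀ n, LexLt (fun i => alphaOne p - b (1 + (n + i))) b := fun n => by
    simpa only [add_comm, add_left_comm, add_assoc] using hlow n
  have hup' : ∀ n, LexLt (fun i => b (1 + (n + i))) b := fun n => by
    simpa only [add_comm, add_left_comm, add_assoc] using hup n
  have hpos : ∀ i, 0 < s i := fun i => by
    cases i with
    | zero => rw [hs0]; exact one_pos
    | succ i =>
      have := hc.tail_le_one hs hs0 hp hlow' i
      rw [add_comm 1 i] at this
      linarith
  refine mem_USet_of_tails hp hs0 hs (fun k => ?_) fun k => ?_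
  · have := (hs.shift 1).tail_lt_one hs hs0 hp hpos hup' k
    rwa [add_comm 1 k] at this
  · have := hc.tail_lt_one hs hs0 hp hpos hlow' k
    rwa [add_comm 1 k] at this

lemma mem_closure_of_lexLt {q : ℝ} (hq : 1 < q) (hqA : q < alphaOne q + 1)
    (hlex : ∀ k : ℕ, LexLt (fun i => alphaOne q - quasiGreedy q 1 (k + 1 + i))
      (quasiGreedy q 1)) : q ∈ closure USet := by
  obtain ⟨r, h0, h, hr⟩ := exists_orbit_quasiGreedy hq
  obtain ⟨hApos, hAlt, -⟩ := alphaOne_spec hq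
  set a := quasiGreedy q 1
  have hconj : ∀ k, alphaOne q / (q - 1) - r (k + 1) < 1 := fun k => by
    have := ((h.shift 1).conj hq).tail_lt_one h h0 hq (fun i => (hr i).1)
      (fun n => by simpa only [add_comm, add_left_comm, add_assoc] using hlex n) k
    rwa [add_comm 1 k] at this
  by_cases hlt : ∀ k, r (k + 1) < 1
  · exact subset_closure (mem_USet_of_tails hq h0 h hlt hconj)
  push Not at hlt
  obtain ⟨k, hk⟩ := hlt
  have hper : ∀ i, a (i + (k + 1)) = a i := fun i => by
    rw [add_comm]
    exact (h.shift (k + 1)).eq_of_mem_Ioc h (by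
      rw [h0]
      exact le_antisymm (hr _).2 hk) (fun i => hr _) hr i
  have ha0 : a 0 = alphaOne q := by
    have h1 := h.succ 0
    have h2 := (hr (0 + 1)).2
    rw [h0] at h1
    have h3 : (alphaOne q : ℝ) < a 0 + 1 := by linarith
    have h4 : alphaOne q < a 0 + 1 := by exact_mod_cast h3
    have h5 := h.digit_le 0
    omega
  have hup : ∀ j x, (∀ i, i < x → a (j + i) = a i) → a (j + x) ≤ a x := fun j x hx =>
    (h.shift j).digit_le_of_agree h hq (by rw [h0]; exact (hr _).2) (fun i => (hr _).1)
      (fun i => (hr i).2) x hx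
  have hlow : ∀ j, LexLt (fun i => alphaOne q - a (j + i)) a := fun j => by
    cases j with
    | zero => exact ⟨0, fun i hi => absurd hi (by omega), by simp [ha0, hApos]⟩
    | succ j => exact hlex j
  choose b hbA hba hbup hblow using
    exists_univoque_approx h.digit_le ha0 hup hlow (Nat.succ_pos k) hper
  have hsum := h.hasSum hq
  rw [h0] at hsum
  refine Metric.mem_closure_iff.2 fun ε hε => ?_
  have hA1 : (1 : ℝ) ≤ alphaOne q := by exact_mod_cast hApos
  obtain ⟨η, hη, hη'⟩ := exists_between
    (show 0 < min ε (min (q - alphaOne q) (alphaOne q + 1 - q)) from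
      lt_min hε (lt_min (by linarith) (by linarith)))
  rw [lt_min_iff, lt_min_iff] at hη'
  obtain ⟨n, p, hp, hp1⟩ := exists_base_near h.digit_le (by omega) hsum hbA hba hη
    (by linarith [hη'.2.1])
  have hpA : alphaOne p = alphaOne q :=
    alphaOne_eq (by linarith [hη'.2.1, hp.1]) (by linarith [hη'.2.2, hp.2])
  refine ⟨p, mem_USet_of_lexLt (b := b n) (by linarith [hη'.2.1, hp.1])
    (by rw [hpA]; linarith [hη'.2.2, hp.2]) ⟨by rw [hpA]; exact hbA n, hp1⟩ (hbup n)
    (by rw [hpA]; exact hblow n), ?_⟩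
  rw [Real.dist_eq, abs_lt]
  constructor <;> linarith [hp.1, hp.2, hη'.1]

/-- `q > 1` belongs to the closure of `U` iff the conjugated shifts
of the quasi-greedy expansion of `1` in base `q` are all lexicographically strictly
smaller than `(α_i)`. -/
theorem mem_closure_univoque_iff (q : ℝ) (hq : 1 < q) :
    q ∈ closure USet ↔
      ∀ k : ℕ, LexLt (fun i => alphaOne q - quasiGreedy q 1 (k + 1 + i))
        (quasiGreedy q 1) := by
  obtain ⟨r, h0, h, hr⟩ := exists_orbit_quasiGreedy hq
  have lex_of_tail : (∀ k, alphaOne q / (q - 1) - r (k + 1) < 1) →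
      ∀ k : ℕ, LexLt (fun i => alphaOne q - quasiGreedy q 1 (k + 1 + i)) (quasiGreedy q 1) :=
    fun ht k => ((h.shift (k + 1)).conj hq).lexLt h hq (by rw [h0]; exact ht k) fun i => (hr i).2
  rcases (alphaOne_spec hq).2.2.eq_or_lt with hqA | hqA
  · have hone : (alphaOne q : ℝ) / (q - 1) = 1 := by
      rw [div_eq_one_iff_eq (by linarith)]
      linarith
    refine iff_of_true (subset_closure (mem_USet_of_eq_alphaOne_add_one hq hqA))
      (lex_of_tail fun k => ?_)
    linarith [(hr (k + 1)).1]
  · exact ⟨fun hcl => lex_of_tail (conj_tail_lt_one_of_mem_closure hq hqA hcl h0 h hr),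
      mem_closure_of_lexLt hq hqA⟩
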